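/- Let ω ∈ ℝ^n and let f : T^n → ℝ be continuous. Define ψ_0(t) = cosh²(t)/(1 + cosh t)³ and ψ_θ(t) = ψ_0(t − θ). There exist μ_0 > 0 and C > 0, depending only on sup|f|, such that for every |μ| < μ_0 and every A ∈ ℝ^n, θ ∈ ℝ, there is a unique pair (Q, α) consisting of a continuous function Q : ℝ → ℝ with sup_{t∈ℝ}|Q(t) − q_θ(t)| ≤ C|μ| and a real constant α, such that Q is C² on ℝ and solves −Q̈(t) + sin(Q(t)) = μ·sin(Q(t))·f(ωt + A) + α·ψ_θ(t) for all t, satisfies the orthogonality condition ∫_ℝ (Q(t) − q_θ(t))·ψ_θ(t) dt = 0, tends to 0 as t → −∞ and to 2π as t → +∞. -/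

import Mathlib

open Real Filter MeasureTheory

/-- The unperturbed pendulum separatrix `q₀(t) = 4 arctan(eᵗ)`. -/
noncomputable def q0 (t : ℝ) : ℝ := 4 * Real.arctan (Real.exp t)

/-- `ψ₀(t) = cosh²(t)/(1 + cosh t)³`. -/
noncomputable def psi0 (t : ℝ) : ℝ := Real.cosh t ^ 2 / (1 + Real.cosh t) ^ 3

/-- `(Q, α)` is a modified 1-bump pseudo-heteroclinic solution: `Q` is `C²` on `ℝ`,
solves `-Q̈ + sin Q = μ sin Q · f(ωt + A) + α ψ_θ(t)` on all of `ℝ`, stays `C|μ|`-close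
to the translated separatrix `q_θ`, satisfies the orthogonality condition
`∫_ℝ (Q - q_θ) ψ_θ = 0` and is asymptotic to `0` at `-∞` and to `2π` at `+∞`. -/
def IsModPseudoHet (n : ℕ) (ω : Fin n → ℝ) (f : (Fin n → ℝ) → ℝ) (μ : ℝ)
    (A : Fin n → ℝ) (θ : ℝ) (C : ℝ) (Q : ℝ → ℝ) (α : ℝ) : Prop :=
  Continuous Q ∧
  (∀ t : ℝ, |Q t - q0 (t - θ)| ≤ C * |μ|) ∧
  (∀ t : ℝ,
    HasDerivAt Q (deriv Q t) t ∧
    HasDerivAt (deriv Q)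
      (Real.sin (Q t) - μ * Real.sin (Q t) * f (fun i => ω i * t + A i)
        - α * psi0 (t - θ)) t) ∧
  (∫ t : ℝ, (Q t - q0 (t - θ)) * psi0 (t - θ)) = 0 ∧
  Tendsto Q atBot (nhds 0) ∧
  Tendsto Q atTop (nhds (2 * Real.pi))


namespace ModHet

/-- hyperbolic secant -/
noncomputable def sch (t : ℝ) : ℝ := (Real.cosh t)⁻¹

lemma sch_pos (t : ℝ) : 0 < sch t := inv_pos.2 (Real.cosh_pos t)

lemma sch_le_one (t : ℝ) : sch t ≤ 1 := inv_le_one_of_one_le₀ (Real.one_le_cosh t)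

lemma sch_mul_cosh (t : ℝ) : sch t * Real.cosh t = 1 :=
  inv_mul_cancel₀ (Real.cosh_pos t).ne'

lemma sch_neg (t : ℝ) : sch (-t) = sch t := by simp [sch]

lemma sch_continuous : Continuous sch :=
  Real.continuous_cosh.inv₀ fun t => (Real.cosh_pos t).ne'

lemma sch_le_exp (t : ℝ) : sch t ≤ 2 * Real.exp (-t) := by
  have h1 : Real.exp t ≤ 2 * Real.cosh t := by
    rw [Real.cosh_eq]; linarith [Real.exp_pos (-t)]
  have h2 : Real.exp (-t) * Real.exp t = 1 := by rw [← Real.exp_add]; simp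
  have h3 := sch_mul_cosh t
  have h4 := sch_pos t
  have h5 := Real.exp_pos (-t)
  have : sch t * (Real.exp (-t) * Real.exp t) ≤ sch t * (Real.exp (-t) * (2 * Real.cosh t)) := by
    gcongr
  nlinarith

lemma cosh_ge (t : ℝ) : (1 + t ^ 2) / 4 ≤ Real.cosh t := by
  have h0 : 1 + |t| + |t| ^ 2 / 2 ≤ Real.exp |t| := Real.quadratic_le_exp_of_nonneg (abs_nonneg t)
  have h1 : 1 - |t| ≤ Real.exp (-|t|) := by linarith [Real.add_one_le_exp (-|t|)]
  rw [← Real.cosh_abs, Real.cosh_eq]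
  have := sq_abs t
  nlinarith

lemma sch_integrable : Integrable sch := by
  refine (integrable_inv_one_add_sq.const_mul 4).mono' sch_continuous.aestronglyMeasurable ?_
  refine Eventually.of_forall fun t => ?_
  rw [Real.norm_of_nonneg (sch_pos t).le]
  have := cosh_ge t
  have h : (0:ℝ) < (1 + t ^ 2) / 4 := by positivity
  calc sch t ≤ ((1 + t ^ 2) / 4)⁻¹ := inv_anti₀ h this
    _ = _ := by rw [inv_div]; ring

lemma sch_tendsto : Tendsto sch (cocompact ℝ) (nhds 0) := by
  have h1 : Tendsto sch atTop (nhds 0) := by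
    refine squeeze_zero (fun t => (sch_pos t).le) sch_le_exp ?_
    simpa using (Real.tendsto_exp_neg_atTop_nhds_zero).const_mul 2
  rw [cocompact_eq_atBot_atTop, tendsto_sup]
  refine ⟨?_, h1⟩
  have := h1.comp tendsto_neg_atBot_atTop
  refine this.congr fun t => by simp [sch_neg]

lemma psi0_pos (t : ℝ) : 0 < psi0 t := by
  have := Real.cosh_pos t
  unfold psi0; positivity

lemma psi0_le_sch (t : ℝ) : psi0 t ≤ sch t := by
  have := Real.cosh_pos t
  unfold psi0 sch
  rw [div_le_iff₀ (by positivity), inv_mul_eq_div, le_div_iff₀ this]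
  nlinarith [pow_pos this 3, pow_pos this 2]

lemma psi0_continuous : Continuous psi0 := by
  unfold psi0
  refine (Real.continuous_cosh.pow 2).div ((continuous_const.add Real.continuous_cosh).pow 3) ?_
  intro t
  have := Real.cosh_pos t
  positivity

lemma psi0_integrable : Integrable psi0 :=
  sch_integrable.mono' psi0_continuous.aestronglyMeasurable
    (Eventually.of_forall fun t => by
      rw [Real.norm_of_nonneg (psi0_pos t).le]; exact psi0_le_sch t)

lemma psi0_tendsto : Tendsto psi0 (cocompact ℝ) (nhds 0) :=
  squeeze_zero (fun t => (psi0_pos t).le) psi0_le_sch sch_tendsto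

/-- bounded times integrable -/
lemma integrable_bdd_mul {h w : ℝ → ℝ} (hh : Continuous h) (hw : Integrable w) {M : ℝ}
    (hM : ∀ t, |h t| ≤ M) : Integrable fun t => h t * w t :=
  hw.bdd_mul hh.aestronglyMeasurable (Eventually.of_forall hM)

lemma abs_integral_le {h w : ℝ → ℝ} (hw : Integrable w) (hw0 : ∀ t, 0 ≤ w t) {M : ℝ}
    (hM : ∀ t, |h t| ≤ M) : |∫ t, h t * w t| ≤ M * ∫ t, w t := by
  rw [← Real.norm_eq_abs, ← integral_const_mul]
  refine norm_integral_le_of_norm_le (hw.const_mul M) (Eventually.of_forall fun t => ?_)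
  rw [norm_mul, Real.norm_eq_abs, Real.norm_of_nonneg (hw0 t)]
  exact mul_le_mul_of_nonneg_right (hM t) (hw0 t)

/-- ∫ sech -/
noncomputable def SS : ℝ := ∫ t, sch t
/-- ∫ ψ₀ sech -/
noncomputable def PP : ℝ := ∫ t, psi0 t * sch t

lemma psi0_abs_le_one (t : ℝ) : |psi0 t| ≤ 1 := by
  rw [abs_of_pos (psi0_pos t)]; exact (psi0_le_sch t).trans (sch_le_one t)

lemma psi_sch_integrable : Integrable fun t => psi0 t * sch t :=
  integrable_bdd_mul psi0_continuous sch_integrable psi0_abs_le_one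

lemma PP_pos : 0 < PP := by
  unfold PP
  rw [integral_pos_iff_support_of_nonneg
    (fun t => (mul_pos (psi0_pos t) (sch_pos t)).le) psi_sch_integrable]
  have : Function.support (fun t => psi0 t * sch t) = Set.univ := by
    ext t; simpa using ⟨(psi0_pos t).ne', (sch_pos t).ne'⟩
  rw [this]; simp

lemma SS_nonneg : 0 ≤ SS := integral_nonneg fun t => (sch_pos t).le

lemma psi0_int_le : ∫ t, psi0 t ≤ SS :=
  integral_mono psi0_integrable sch_integrable psi0_le_sch

/-- Lemma A, one-sided. -/
lemma lemA {F H : ℝ → ℝ} (hF : ∀ t, HasDerivAt F (H t * sch t) t)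
    (hl : Tendsto F atTop (nhds 0)) {T m : ℝ} (hT : 0 ≤ T) (hm : ∀ t ≥ T, |H t| ≤ m) :
    ∀ t ≥ T, |F t * Real.cosh t| ≤ 2 * m := by
  have hm0 : 0 ≤ m := (abs_nonneg _).trans (hm T le_rfl)
  have key : ∀ (F H : ℝ → ℝ), (∀ t, HasDerivAt F (H t * sch t) t) →
      Tendsto F atTop (nhds 0) → (∀ t ≥ T, |H t| ≤ m) → ∀ t ≥ T, -(2 * m * Real.exp (-t)) ≤ F t := by
    intro F H hF hl hm t ht
    have hd : ∀ s, HasDerivAt (fun s => F s + 2 * m * Real.exp (-s))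
        (H s * sch s + 2 * m * (Real.exp (-s) * (-1))) s := fun s =>
      (hF s).add (((hasDerivAt_neg s).exp).const_mul (2 * m))
    have hanti : AntitoneOn (fun s => F s + 2 * m * Real.exp (-s)) (Set.Ici T) := by
      refine antitoneOn_of_deriv_nonpos (convex_Ici T)
        (fun s _ => (hd s).continuousAt.continuousWithinAt)
        (fun s _ => (hd s).differentiableAt.differentiableWithinAt) ?_
      intro s hs
      rw [interior_Ici] at hs
      rw [(hd s).deriv]
      have h1 := (abs_le.1 (hm s (le_of_lt hs))).2
      have h2 : H s * sch s ≤ m * (2 * Real.exp (-s)) :=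
        mul_le_mul h1 (sch_le_exp s) (sch_pos s).le hm0
      linarith
    have hlim : Tendsto (fun s => F s + 2 * m * Real.exp (-s)) atTop (nhds 0) := by
      simpa using hl.add ((Real.tendsto_exp_neg_atTop_nhds_zero).const_mul (2 * m))
    have : 0 ≤ F t + 2 * m * Real.exp (-t) := by
      refine le_of_tendsto hlim ?_
      filter_upwards [eventually_ge_atTop t] with s hs
      exact hanti ht (le_trans ht hs) hs
    linarith
  intro t ht
  have k1 := key F H hF hl hm t ht
  have k2 := key (fun t => - F t) (fun t => - H t)
    (fun t => ((hF t).neg).congr_deriv (by ring)) (by simpa using hl.neg)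
    (fun t ht => by simpa using hm t ht) t ht
  have h0 : |F t| ≤ 2 * m * Real.exp (-t) := abs_le.2 ⟨k1, by linarith⟩
  have hc : Real.exp (-t) * Real.cosh t ≤ 1 := by
    rw [Real.cosh_eq]
    have h2 : Real.exp (-t) * Real.exp t = 1 := by rw [← Real.exp_add]; simp
    have h3 : Real.exp (-t) ≤ 1 := Real.exp_le_one_iff.2 (by linarith)
    nlinarith [Real.exp_pos (-t)]
  rw [abs_mul, abs_of_pos (Real.cosh_pos t)]
  calc |F t| * Real.cosh t ≤ 2 * m * Real.exp (-t) * Real.cosh t :=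
        mul_le_mul_of_nonneg_right h0 (Real.cosh_pos t).le
    _ = 2 * m * (Real.exp (-t) * Real.cosh t) := by ring
    _ ≤ 2 * m * 1 := by gcongr
    _ = 2 * m := by ring

lemma refl_deriv {F H : ℝ → ℝ} (hF : ∀ t, HasDerivAt F (H t * sch t) t) :
    ∀ t, HasDerivAt (fun t => F (-t)) ((fun t => - H (-t)) t * sch t) t := by
  intro t
  have := (hF (-t)).comp t (hasDerivAt_neg t)
  refine this.congr_deriv ?_
  rw [sch_neg]; ring

lemma refl_deriv' {F H : ℝ → ℝ} (hF : ∀ t, HasDerivAt F (H t * Real.cosh t) t) :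
    ∀ t, HasDerivAt (fun t => F (-t)) ((fun t => - H (-t)) t * Real.cosh t) t := by
  intro t
  have := (hF (-t)).comp t (hasDerivAt_neg t)
  refine this.congr_deriv ?_
  rw [Real.cosh_neg]; ring

lemma lemA_bdd {F H : ℝ → ℝ} (hF : ∀ t, HasDerivAt F (H t * sch t) t)
    (hl : Tendsto F atTop (nhds 0)) (hl' : Tendsto F atBot (nhds 0)) {m : ℝ}
    (hm : ∀ t, |H t| ≤ m) (t : ℝ) : |F t * Real.cosh t| ≤ 2 * m := by
  rcases le_total 0 t with ht | ht
  · exact lemA hF hl le_rfl (fun t _ => hm t) t ht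
  · have := lemA (refl_deriv hF) (hl'.comp tendsto_neg_atTop_atBot) (m := m) le_rfl
      (fun t _ => by simpa using hm (-t)) (-t) (by simpa using ht)
    simpa using this

lemma lemA_top {F H : ℝ → ℝ} (hF : ∀ t, HasDerivAt F (H t * sch t) t)
    (hl : Tendsto F atTop (nhds 0)) (hH : Tendsto H atTop (nhds 0)) :
    Tendsto (fun t => F t * Real.cosh t) atTop (nhds 0) := by
  rw [Metric.tendsto_atTop] at hH ⊢
  intro ε hε
  obtain ⟨N, hN⟩ := hH (ε / 4) (by positivity)
  refine ⟨max N 0, fun t ht => ?_⟩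
  have := lemA hF hl (T := max N 0) (m := ε / 4) (le_max_right _ _)
    (fun t ht => by
      have := hN t (le_trans (le_max_left _ _) ht)
      rw [Real.dist_eq, sub_zero] at this; exact this.le) t ht
  rw [Real.dist_eq, sub_zero]; linarith

lemma lemA_cc {F H : ℝ → ℝ} (hF : ∀ t, HasDerivAt F (H t * sch t) t)
    (hl : Tendsto F atTop (nhds 0)) (hl' : Tendsto F atBot (nhds 0))
    (hH : Tendsto H (cocompact ℝ) (nhds 0)) :
    Tendsto (fun t => F t * Real.cosh t) (cocompact ℝ) (nhds 0) := by
  rw [cocompact_eq_atBot_atTop, tendsto_sup] at hH ⊢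
  refine ⟨?_, lemA_top hF hl hH.2⟩
  have h1 := lemA_top (refl_deriv hF) (hl'.comp tendsto_neg_atTop_atBot)
    (by simpa using (hH.1.comp tendsto_neg_atTop_atBot).neg)
  have := h1.comp tendsto_neg_atBot_atTop
  refine this.congr fun t => by simp

/-- Lemma B, one-sided. -/
lemma lemB {G u : ℝ → ℝ} (hG : ∀ t, HasDerivAt G (u t * Real.cosh t) t)
    {T m : ℝ} (hT : 0 ≤ T) (hm : ∀ t ≥ T, |u t| ≤ m) :
    ∀ t ≥ T, |G t - G T| ≤ m * Real.cosh t := by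
  have hm0 : 0 ≤ m := (abs_nonneg _).trans (hm T le_rfl)
  have key : ∀ (G u : ℝ → ℝ), (∀ t, HasDerivAt G (u t * Real.cosh t) t) →
      (∀ t ≥ T, |u t| ≤ m) → ∀ t ≥ T, G t - G T ≤ m * Real.cosh t := by
    intro G u hG hm t ht
    have hd : ∀ s, HasDerivAt (fun s => G s - m * Real.sinh s)
        (u s * Real.cosh s - m * Real.cosh s) s := fun s =>
      (hG s).sub ((Real.hasDerivAt_sinh s).const_mul m)
    have hanti : AntitoneOn (fun s => G s - m * Real.sinh s) (Set.Ici T) := by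
      refine antitoneOn_of_deriv_nonpos (convex_Ici T)
        (fun s _ => (hd s).continuousAt.continuousWithinAt)
        (fun s _ => (hd s).differentiableAt.differentiableWithinAt) ?_
      intro s hs
      rw [interior_Ici] at hs
      rw [(hd s).deriv]
      have h1 := (abs_le.1 (hm s (le_of_lt hs))).2
      have := mul_le_mul_of_nonneg_right h1 (Real.cosh_pos s).le
      linarith
    have h1 : G t - m * Real.sinh t ≤ G T - m * Real.sinh T :=
      hanti (Set.mem_Ici.2 le_rfl) ht ht
    have h2 : 0 ≤ Real.sinh T := Real.sinh_nonneg_iff.2 hT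
    have h3 := mul_nonneg hm0 h2
    have h4 := mul_le_mul_of_nonneg_left (Real.sinh_lt_cosh t).le hm0
    linarith
  intro t ht
  have k1 := key G u hG hm t ht
  have k2 := key (fun t => - G t) (fun t => - u t)
    (fun t => ((hG t).neg).congr_deriv (by ring))
    (fun t ht => by simpa using hm t ht) t ht
  exact abs_le.2 ⟨by linarith, k1⟩

lemma lemB_bdd {G u : ℝ → ℝ} (hG : ∀ t, HasDerivAt G (u t * Real.cosh t) t)
    {m : ℝ} (hm : ∀ t, |u t| ≤ m) (t : ℝ) : |G t - G 0| ≤ m * Real.cosh t := by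
  rcases le_total 0 t with ht | ht
  · exact lemB hG le_rfl (fun t _ => hm t) t ht
  · have := lemB (refl_deriv' hG) (m := m) le_rfl
      (fun t _ => by simpa using hm (-t)) (-t) (by simpa using ht)
    simpa using this

lemma lemB_top {G u : ℝ → ℝ} (hG : ∀ t, HasDerivAt G (u t * Real.cosh t) t)
    (hu : Tendsto u atTop (nhds 0)) :
    Tendsto (fun t => G t * sch t) atTop (nhds 0) := by
  have hs : Tendsto sch atTop (nhds 0) := sch_tendsto.mono_left atTop_le_cocompact
  rw [Metric.tendsto_atTop] at hu ⊢
  intro ε hε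
  obtain ⟨N, hN⟩ := hu (ε / 2) (by positivity)
  have hs2 : Tendsto (fun t => |G (max N 0)| * sch t) atTop (nhds 0) := by
    simpa using hs.const_mul (|G (max N 0)|)
  obtain ⟨N2, hN2⟩ := eventually_atTop.1 (hs2.eventually (gt_mem_nhds (half_pos hε)))
  refine ⟨max N2 (max N 0), fun t ht => ?_⟩
  have h1 := lemB hG (T := max N 0) (m := ε / 2) (le_max_right _ _)
    (fun t ht => by
      have := hN t (le_trans (le_max_left _ _) ht)
      rw [Real.dist_eq, sub_zero] at this; exact this.le) t (le_trans (le_max_right _ _) ht)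
  have h2 := hN2 t (le_trans (le_max_left _ _) ht)
  have h3 : |G t| ≤ ε / 2 * Real.cosh t + |G (max N 0)| := by
    have := abs_add_le (G t - G (max N 0)) (G (max N 0))
    rw [sub_add_cancel] at this; linarith
  rw [Real.dist_eq, sub_zero, abs_mul, abs_of_pos (sch_pos t)]
  have h4 := mul_le_mul_of_nonneg_right h3 (sch_pos t).le
  have h5 := sch_mul_cosh t
  have h6 : (ε / 2 * Real.cosh t + |G (max N 0)|) * sch t
    = ε / 2 * (sch t * Real.cosh t) + |G (max N 0)| * sch t := by ring
  rw [h6, h5] at h4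
  linarith

lemma lemB_cc {G u : ℝ → ℝ} (hG : ∀ t, HasDerivAt G (u t * Real.cosh t) t)
    (hu : Tendsto u (cocompact ℝ) (nhds 0)) :
    Tendsto (fun t => G t * sch t) (cocompact ℝ) (nhds 0) := by
  rw [cocompact_eq_atBot_atTop, tendsto_sup] at hu ⊢
  refine ⟨?_, lemB_top hG hu.2⟩
  have h1 := lemB_top (refl_deriv' hG)
    (by simpa using (hu.1.comp tendsto_neg_atTop_atBot).neg)
  have := h1.comp tendsto_neg_atBot_atTop
  refine this.congr fun t => by simp [sch_neg]

lemma sch_hasDerivAt (t : ℝ) : HasDerivAt sch (-(Real.sinh t * sch t ^ 2)) t := by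
  have := (Real.hasDerivAt_cosh t).inv (Real.cosh_pos t).ne'
  refine this.congr_deriv ?_
  unfold sch
  rw [inv_pow]; ring

lemma sinh_sch_sq (t : ℝ) : Real.sinh t ^ 2 * sch t ^ 2 = 1 - sch t ^ 2 := by
  have h1 := Real.cosh_sq t
  have h2 := sch_mul_cosh t
  have : sch t ^ 2 * Real.cosh t ^ 2 = 1 := by rw [← mul_pow, h2]; simp
  rw [h1] at this; linarith

lemma abs_sinh_sch (t : ℝ) : |Real.sinh t * sch t| ≤ 1 := by
  have h := sinh_sch_sq t
  refine abs_le_one_iff_mul_self_le_one.2 ?_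
  nlinarith [sq_nonneg (sch t)]

/-- The linear equation. -/
def LinEq (v w k : ℝ → ℝ) (β : ℝ) : Prop :=
  (∀ t, HasDerivAt v (w t) t) ∧
  (∀ t, HasDerivAt w ((1 - 2 * sch t ^ 2) * v t + k t - β * psi0 t) t) ∧
  (∫ t, v t * psi0 t) = 0

/-- Landau-type bound. -/
lemma deriv_bdd {v w z : ℝ → ℝ} (hv : ∀ t, HasDerivAt v (w t) t)
    (hw : ∀ t, HasDerivAt w (z t) t) {D E : ℝ} (hD : ∀ t, |v t| ≤ D) (hE : ∀ t, |z t| ≤ E)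
    (t : ℝ) : |w t| ≤ 2 * D + E := by
  obtain ⟨ξ, hξ, h1⟩ := exists_hasDerivAt_eq_slope v w (by linarith : t < t + 1)
    (fun s _ => (hv s).continuousAt.continuousWithinAt) (fun s _ => hv s)
  obtain ⟨η, hη, h2⟩ := exists_hasDerivAt_eq_slope w z hξ.1
    (fun s _ => (hw s).continuousAt.continuousWithinAt) (fun s _ => hw s)
  have hpos : 0 < ξ - t := by linarith [hξ.1]
  have h3 : w ξ = v (t + 1) - v t := by rw [h1]; simp
  have h4 : z η * (ξ - t) = w ξ - w t := by rw [h2]; field_simp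
  have h5 : |z η * (ξ - t)| ≤ E := by
    rw [abs_mul, abs_of_pos hpos]
    have := hE η
    have h0 := abs_nonneg (z η)
    nlinarith [hξ.2]
  have e1 := abs_le.1 (hD (t+1))
  have e2 := abs_le.1 (hD t)
  have e3 := abs_le.1 h5
  rw [abs_le]; constructor <;> linarith [e1.1, e1.2, e2.1, e2.2, e3.1, e3.2]

/-- the constant in the a priori estimate -/
noncomputable def KK : ℝ := 2 * (1 + SS / PP) ^ 2

lemma ratio_nonneg : 0 ≤ SS / PP := div_nonneg SS_nonneg PP_pos.le

lemma KK_pos : 0 < KK := by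
  have := ratio_nonneg
  unfold KK; positivity

/-- A priori estimate. -/
lemma apriori {v w k : ℝ → ℝ} {β D M : ℝ} (h : LinEq v w k β) (hk : Continuous k)
    (hD : ∀ t, |v t| ≤ D) (hM : ∀ t, |k t| ≤ M) :
    (∀ t, |v t| ≤ KK * M) ∧ |β| ≤ KK * M := by
  obtain ⟨hv, hw, horth⟩ := h
  have hM0 : 0 ≤ M := (abs_nonneg _).trans (hM 0)
  have hD0 : 0 ≤ D := (abs_nonneg _).trans (hD 0)
  have hvc : Continuous v := continuous_iff_continuousAt.2 fun t => (hv t).continuousAt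
  set H : ℝ → ℝ := fun t => k t - β * psi0 t with hH
  have hHb : ∀ t, |H t| ≤ M + |β| := by
    intro t
    have h1 : |β * psi0 t| ≤ |β| := by
      rw [abs_mul]; exact mul_le_of_le_one_right (abs_nonneg _) (psi0_abs_le_one t)
    have h2 := abs_sub (k t) (β * psi0 t)
    have h3 := hM t
    simp only [hH]; linarith
  have hHc : Continuous H := hk.sub (continuous_const.mul psi0_continuous)
  -- bound on w
  have hwb : ∀ t, |w t| ≤ 2 * D + (D + (M + |β|)) := by
    refine deriv_bdd hv hw hD ?_
    intro t
    have h1 : |(1 - 2 * sch t ^ 2)| ≤ 1 := by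
      have h1 := sch_pos t
      have h2 := sch_le_one t
      rw [abs_le]; constructor <;> nlinarith
    have h2 : |(1 - 2 * sch t ^ 2) * v t| ≤ D := by
      rw [abs_mul]
      have := hD t
      have := abs_nonneg (v t)
      nlinarith
    have h3 := abs_add_le ((1 - 2 * sch t ^ 2) * v t) (H t)
    have h4 := hHb t
    have e : (1 - 2 * sch t ^ 2) * v t + k t - β * psi0 t = (1 - 2 * sch t ^ 2) * v t + H t := by
      simp only [hH]; ring
    rw [e]; linarith
  set u : ℝ → ℝ := fun t => w t + v t * (Real.sinh t * sch t) with hu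
  have hub : ∀ t, |u t| ≤ 2 * D + (D + (M + |β|)) + D := by
    intro t
    have h1 : |v t * (Real.sinh t * sch t)| ≤ D := by
      rw [abs_mul]
      have h2 := hD t
      have h3 := abs_sinh_sch t
      have := abs_nonneg (v t)
      nlinarith
    have h2 := abs_add_le (w t) (v t * (Real.sinh t * sch t))
    have h3 := hwb t
    simp only [hu]; linarith
  set F : ℝ → ℝ := fun t => u t * sch t with hF
  have hFd : ∀ t, HasDerivAt F (H t * sch t) t := by
    intro t
    have := ((hw t).add ((hv t).mul ((Real.hasDerivAt_sinh t).mul (sch_hasDerivAt t)))).mul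
      (sch_hasDerivAt t)
    refine this.congr_deriv ?_
    have e1 := sinh_sch_sq t
    have e2 := sch_mul_cosh t
    simp only [hH, Pi.add_apply, Pi.mul_apply]
    linear_combination (v t * sch t) * e2 + (-2 * v t * sch t) * e1
  have hFcc : Tendsto F (cocompact ℝ) (nhds 0) := by
    refine squeeze_zero_norm (a := fun t => (2 * D + (D + (M + |β|)) + D) * sch t) ?_ ?_
    · intro t
      simp only [hF]
      rw [norm_mul, Real.norm_eq_abs, Real.norm_of_nonneg (sch_pos t).le]
      exact mul_le_mul_of_nonneg_right (hub t) (sch_pos t).le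
    · simpa using sch_tendsto.const_mul (2 * D + (D + (M + |β|)) + D)
  have hFtop := hFcc.mono_left atTop_le_cocompact
  have hFbot := hFcc.mono_left atBot_le_cocompact
  have hint : ∫ t, H t * sch t = 0 := by
    have := integral_of_hasDerivAt_of_tendsto hFd (integrable_bdd_mul hHc sch_integrable hHb)
      hFbot hFtop
    simpa using this
  have hβ : β * PP = ∫ t, k t * sch t := by
    have e : ∀ t, H t * sch t = k t * sch t - β * (psi0 t * sch t) := fun t => by
      simp only [hH]; ring
    simp_rw [e] at hint
    rw [integral_sub (integrable_bdd_mul hk sch_integrable hM) (psi_sch_integrable.const_mul β),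
      integral_const_mul] at hint
    unfold PP; linarith
  have hP := PP_pos
  have hβb : |β| ≤ M * (SS / PP) := by
    have h1 := abs_integral_le sch_integrable (fun t => (sch_pos t).le) hM
    rw [← hβ, abs_mul, abs_of_pos hP] at h1
    rw [← mul_div_assoc, le_div_iff₀ hP]; exact h1
  set R := SS / PP with hR
  have hR0 : 0 ≤ R := ratio_nonneg
  have hHb2 : ∀ t, |H t| ≤ M * (1 + R) := fun t => by linarith [hHb t]
  have hub2 : ∀ t, |u t| ≤ 2 * (M * (1 + R)) := by
    intro t
    have := lemA_bdd hFd hFtop hFbot hHb2 t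
    have e : F t * Real.cosh t = u t := by
      simp only [hF]; rw [mul_assoc, sch_mul_cosh, mul_one]
    rwa [e] at this
  set m := 2 * (M * (1 + R)) with hm
  have hm0 : 0 ≤ m := (abs_nonneg _).trans (hub2 0)
  have hG : ∀ t, HasDerivAt (fun t => v t * Real.cosh t) (u t * Real.cosh t) t := by
    intro t
    refine ((hv t).mul (Real.hasDerivAt_cosh t)).congr_deriv ?_
    have e2 := sch_mul_cosh t
    simp only [hu]
    linear_combination (-v t * Real.sinh t) * e2
  have hGb := lemB_bdd hG hub2
  have hz : ∀ t, |v t - v 0 * sch t| ≤ m := by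
    intro t
    have h1 := hGb t
    have hc := Real.cosh_pos t
    have e : v t * Real.cosh t - v 0 * Real.cosh 0 = (v t - v 0 * sch t) * Real.cosh t := by
      rw [Real.cosh_zero]
      linear_combination (v 0) * sch_mul_cosh t
    rw [e, abs_mul, abs_of_pos hc] at h1
    exact le_of_mul_le_mul_right h1 hc
  have hzi : ∫ t, (v t - v 0 * sch t) * psi0 t = - (v 0 * PP) := by
    have e : ∀ t, (v t - v 0 * sch t) * psi0 t = v t * psi0 t - v 0 * (psi0 t * sch t) :=
      fun t => by ring
    simp_rw [e]
    rw [integral_sub (integrable_bdd_mul hvc psi0_integrable hD) (psi_sch_integrable.const_mul _),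
      integral_const_mul, horth]
    unfold PP; ring
  have hv0 : |v 0| ≤ m * R := by
    have h1 := abs_integral_le psi0_integrable (fun t => (psi0_pos t).le) hz
    rw [hzi, abs_neg, abs_mul, abs_of_pos hP] at h1
    have h2 := mul_le_mul_of_nonneg_left psi0_int_le hm0
    rw [hR, ← mul_div_assoc, le_div_iff₀ hP]; linarith
  have hKK : KK * M = m * (1 + R) := by
    simp only [KK, hm, ← hR]; ring
  refine ⟨fun t => ?_, ?_⟩
  · rw [hKK]
    have h1 := abs_add_le (v t - v 0 * sch t) (v 0 * sch t)
    rw [sub_add_cancel] at h1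
    have h2 : |v 0 * sch t| ≤ |v 0| := by
      rw [abs_mul, abs_of_pos (sch_pos t)]
      exact mul_le_of_le_one_right (abs_nonneg _) (sch_le_one t)
    linarith [hz t]
  · rw [hKK]
    have : 0 ≤ M * R := mul_nonneg hM0 hR0
    have : 0 ≤ M * R * R := mul_nonneg this hR0
    nlinarith

lemma bdd_of_tendsto {h : ℝ → ℝ} (hc : Continuous h) (ht : Tendsto h (cocompact ℝ) (nhds 0)) :
    ∃ M, ∀ t, |h t| ≤ M := by
  let g : ZeroAtInftyContinuousMap ℝ ℝ := ⟨⟨h, hc⟩, ht⟩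
  exact ⟨‖g.toBCF‖, fun t => g.toBCF.norm_coe_le_norm t⟩

/-- Solvability of the linear equation. -/
lemma linExists {k : ℝ → ℝ} (hk : Continuous k) (hk0 : Tendsto k (cocompact ℝ) (nhds 0)) :
    ∃ (v w : ℝ → ℝ) (β : ℝ), LinEq v w k β ∧ Tendsto v (cocompact ℝ) (nhds 0) := by
  obtain ⟨M, hM⟩ := bdd_of_tendsto hk hk0
  have hP := PP_pos
  set β := (∫ t, k t * sch t) / PP with hβ
  set H : ℝ → ℝ := fun t => k t - β * psi0 t with hH
  have hHc : Continuous H := hk.sub (continuous_const.mul psi0_continuous)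
  have hH0 : Tendsto H (cocompact ℝ) (nhds 0) := by
    simpa using hk0.sub (psi0_tendsto.const_mul β)
  obtain ⟨M2, hHb⟩ := bdd_of_tendsto hHc hH0
  have hHi := integrable_bdd_mul hHc sch_integrable hHb
  have hint : ∫ t, H t * sch t = 0 := by
    have e : ∀ t, H t * sch t = k t * sch t - β * (psi0 t * sch t) := fun t => by
      simp only [hH]; ring
    simp_rw [e]
    rw [integral_sub (integrable_bdd_mul hk sch_integrable hM) (psi_sch_integrable.const_mul β),
      integral_const_mul]
    change _ - β * PP = 0
    rw [hβ, div_mul_cancel₀ _ hP.ne', sub_self]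
  have hHsc : Continuous fun t => H t * sch t := hHc.mul sch_continuous
  set c0 := ∫ t in Set.Iic (0:ℝ), H t * sch t with hc0
  have hsplit : c0 + ∫ t in Set.Ioi (0:ℝ), H t * sch t = 0 := by
    rw [hc0, intervalIntegral.integral_Iic_add_Ioi hHi.integrableOn hHi.integrableOn]
    exact hint
  set F : ℝ → ℝ := fun t => c0 + ∫ s in (0:ℝ)..t, H s * sch s with hF
  have hFd : ∀ t, HasDerivAt F (H t * sch t) t := by
    intro t
    exact (hHsc.integral_hasStrictDerivAt 0 t).hasDerivAt.const_add c0
  have hFtop : Tendsto F atTop (nhds 0) := by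
    have := (intervalIntegral_tendsto_integral_Ioi (0:ℝ) hHi.integrableOn tendsto_id).const_add c0
    rw [hsplit] at this
    exact this
  have hFbot : Tendsto F atBot (nhds 0) := by
    have := (intervalIntegral_tendsto_integral_Iic (0:ℝ) hHi.integrableOn tendsto_id).const_sub c0
    rw [← hc0, sub_self] at this
    refine this.congr fun t => ?_
    simp only [hF, id]
    rw [intervalIntegral.integral_symm 0 t]; ring
  set u : ℝ → ℝ := fun t => F t * Real.cosh t with hu
  have hu0 : Tendsto u (cocompact ℝ) (nhds 0) := lemA_cc hFd hFtop hFbot hH0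
  have hFc : Continuous F := continuous_iff_continuousAt.2 fun t => (hFd t).continuousAt
  have hud : ∀ t, HasDerivAt u (H t + F t * Real.sinh t) t := by
    intro t
    refine ((hFd t).mul (Real.hasDerivAt_cosh t)).congr_deriv ?_
    linear_combination H t * sch_mul_cosh t
  have huc : Continuous fun t => u t * Real.cosh t :=
    (hFc.mul Real.continuous_cosh).mul Real.continuous_cosh
  set G : ℝ → ℝ := fun t => ∫ s in (0:ℝ)..t, u s * Real.cosh s with hG
  have hGd : ∀ t, HasDerivAt G (u t * Real.cosh t) t := fun t =>
    (huc.integral_hasStrictDerivAt 0 t).hasDerivAt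
  have hz0 : Tendsto (fun t => G t * sch t) (cocompact ℝ) (nhds 0) := lemB_cc hGd hu0
  have hGc : Continuous G := continuous_iff_continuousAt.2 fun t => (hGd t).continuousAt
  have hzc : Continuous fun t => G t * sch t := hGc.mul sch_continuous
  obtain ⟨M3, hzb⟩ := bdd_of_tendsto hzc hz0
  set c := - (∫ t, (G t * sch t) * psi0 t) / PP with hc
  set v : ℝ → ℝ := fun t => (G t + c) * sch t with hv
  set w : ℝ → ℝ := fun t => u t - (Real.sinh t * sch t) * v t with hw
  have hvd : ∀ t, HasDerivAt v (w t) t := by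
    intro t
    refine (((hGd t).add_const c).mul (sch_hasDerivAt t)).congr_deriv ?_
    simp only [hw, hv]
    linear_combination u t * sch_mul_cosh t
  refine ⟨v, w, β, ⟨hvd, ?_, ?_⟩, ?_⟩
  · intro t
    refine ((hud t).sub (((Real.hasDerivAt_sinh t).mul (sch_hasDerivAt t)).mul (hvd t))).congr_deriv
      ?_
    have e1 := sinh_sch_sq t
    have e2 := sch_mul_cosh t
    have e3 : u t * sch t = F t := by
      simp only [hu]; linear_combination F t * e2
    simp only [Pi.mul_apply]
    have e4 : w t = u t - (Real.sinh t * sch t) * v t := rfl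
    have e5 : H t = k t - β * psi0 t := rfl
    rw [e4, e5, ← e3]
    linear_combination (-v t) * e2 + (2 * v t) * e1
  · have e : ∀ t, v t * psi0 t = (G t * sch t) * psi0 t + c * (psi0 t * sch t) := fun t => by
      simp only [hv]; ring
    simp_rw [e]
    rw [integral_add (integrable_bdd_mul hzc psi0_integrable hzb) (psi_sch_integrable.const_mul _),
      integral_const_mul]
    change _ + c * PP = 0
    rw [hc, div_mul_cancel₀ _ hP.ne']; ring
  · have := hz0.add (sch_tendsto.const_mul c)
    simp only [mul_zero, add_zero] at this
    refine this.congr fun t => ?_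
    simp only [hv]; ring

lemma sch_eq (t : ℝ) : sch t = 2 * Real.exp t / (1 + Real.exp t ^ 2) := by
  unfold sch
  rw [Real.cosh_eq, Real.exp_neg]
  have := Real.exp_pos t
  field_simp
  ring

lemma cos_sq_at (t : ℝ) :
    Real.cos (Real.arctan (Real.exp t)) ^ 2 = 1 / (1 + Real.exp t ^ 2) := Real.cos_sq_arctan _

lemma sin_two_at (t : ℝ) : Real.sin (2 * Real.arctan (Real.exp t)) = sch t := by
  have hc : Real.cos (Real.arctan (Real.exp t)) ≠ 0 := (Real.cos_arctan_pos _).ne'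
  have hs : Real.sin (Real.arctan (Real.exp t))
      = Real.exp t * Real.cos (Real.arctan (Real.exp t)) := by
    have := Real.tan_mul_cos hc
    rw [Real.tan_arctan] at this; exact this.symm
  rw [Real.sin_two_mul, hs, sch_eq]
  have := cos_sq_at t
  linear_combination (2 * Real.exp t) * this

lemma cos_two_at (t : ℝ) : Real.cos (2 * Real.arctan (Real.exp t)) = -(Real.sinh t * sch t) := by
  rw [Real.cos_two_mul, cos_sq_at, sch_eq, Real.sinh_eq, Real.exp_neg]
  have := Real.exp_pos t
  field_simp
  ring

lemma cos_q0 (t : ℝ) : Real.cos (q0 t) = 1 - 2 * sch t ^ 2 := by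
  have e : q0 t = 2 * (2 * Real.arctan (Real.exp t)) := by unfold q0; ring
  rw [e, Real.cos_two_mul, cos_two_at]
  linear_combination 2 * sinh_sch_sq t

lemma sin_q0 (t : ℝ) : Real.sin (q0 t) = -(2 * (Real.sinh t * sch t ^ 2)) := by
  have e : q0 t = 2 * (2 * Real.arctan (Real.exp t)) := by unfold q0; ring
  rw [e, Real.sin_two_mul, cos_two_at, sin_two_at]
  ring

lemma abs_sin_q0 (t : ℝ) : |Real.sin (q0 t)| ≤ 2 * sch t := by
  have e : Real.sin (q0 t) = -(2 * sch t) * (Real.sinh t * sch t) := by rw [sin_q0]; ring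
  rw [e, abs_mul, abs_neg, abs_of_pos (by linarith [sch_pos t])]
  exact mul_le_of_le_one_right (by linarith [sch_pos t]) (abs_sinh_sch t)

lemma q0_hasDerivAt (t : ℝ) : HasDerivAt q0 (2 * sch t) t := by
  have := ((Real.hasDerivAt_exp t).arctan).const_mul 4
  refine this.congr_deriv ?_
  rw [sch_eq]
  field_simp
  ring

lemma q0_hasDerivAt2 (t : ℝ) : HasDerivAt (fun t => 2 * sch t) (Real.sin (q0 t)) t := by
  refine ((sch_hasDerivAt t).const_mul 2).congr_deriv ?_
  rw [sin_q0]; ring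

lemma q0_continuous : Continuous q0 :=
  continuous_iff_continuousAt.2 fun t => (q0_hasDerivAt t).continuousAt

lemma q0_bot : Tendsto q0 atBot (nhds 0) := by
  have h := (Real.continuous_arctan.tendsto 0).comp Real.tendsto_exp_atBot
  rw [Real.arctan_zero] at h
  have h2 := h.const_mul 4
  rw [mul_zero] at h2
  exact h2

lemma q0_top : Tendsto q0 atTop (nhds (2 * Real.pi)) := by
  have h := (tendsto_nhds_of_tendsto_nhdsWithin Real.tendsto_arctan_atTop).comp
    Real.tendsto_exp_atTop
  have h2 := h.const_mul 4
  have e : 4 * (Real.pi / 2) = 2 * Real.pi := by ring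
  rw [e] at h2
  exact h2

/-- the nonlinearity -/
noncomputable def NL (μ g q a : ℝ) : ℝ :=
  Real.sin (q + a) - Real.sin q - Real.cos q * a - μ * Real.sin (q + a) * g

lemma NL_lip {μ g q a b r B : ℝ} (ha : |a| ≤ r) (hb : |b| ≤ r) (hg : |g| ≤ B) :
    |NL μ g q a - NL μ g q b| ≤ (r + |μ| * B) * |a - b| := by
  have h1 : ‖(Real.sin (q + a) - Real.cos q * a) - (Real.sin (q + b) - Real.cos q * b)‖
      ≤ r * ‖a - b‖ := by
    refine Convex.norm_image_sub_le_of_norm_hasDerivWithin_le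
      (f := fun x => Real.sin (q + x) - Real.cos q * x)
      (f' := fun x => Real.cos (q + x) - Real.cos q) (s := Set.Icc (-r) r) ?_ ?_
      (convex_Icc _ _) (abs_le.1 hb) (abs_le.1 ha)
    · intro x _
      have h := (((hasDerivAt_id x).const_add q).sin).sub ((hasDerivAt_id x).const_mul (Real.cos q))
      refine (h.congr_deriv ?_).hasDerivWithinAt
      simp
    · intro x hx
      have h := Real.abs_cos_sub_cos_le (q + x) q
      rw [add_sub_cancel_left] at h
      exact h.trans (abs_le.2 hx)
  have h2 : |μ * g * (Real.sin (q + a) - Real.sin (q + b))| ≤ |μ| * B * |a - b| := by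
    have h := Real.abs_sin_sub_sin_le (q + a) (q + b)
    rw [add_sub_add_left_eq_sub] at h
    rw [abs_mul, abs_mul]
    gcongr
    exact mul_nonneg (abs_nonneg _) ((abs_nonneg _).trans hg)
  rw [Real.norm_eq_abs, Real.norm_eq_abs] at h1
  have e : NL μ g q a - NL μ g q b = ((Real.sin (q + a) - Real.cos q * a)
      - (Real.sin (q + b) - Real.cos q * b)) - μ * g * (Real.sin (q + a) - Real.sin (q + b)) := by
    unfold NL; ring
  rw [e]
  refine (abs_sub _ _).trans ?_
  linarith

lemma NL_zero {μ g q B : ℝ} (hg : |g| ≤ B) : |NL μ g q 0| ≤ |μ| * B * |Real.sin q| := by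
  have e : NL μ g q 0 = - (μ * g * Real.sin q) := by unfold NL; simp; ring
  rw [e, abs_neg, abs_mul, abs_mul]
  gcongr

lemma NL_continuous {μ : ℝ} {g v : ℝ → ℝ} (hg : Continuous g) (hv : Continuous v) :
    Continuous fun t => NL μ (g t) (q0 t) (v t) := by
  have := q0_continuous
  unfold NL; fun_prop

lemma NL_tendsto {μ B : ℝ} {g v : ℝ → ℝ} (hgB : ∀ t, |g t| ≤ B)
    (hvc : Continuous v) (hv : Tendsto v (cocompact ℝ) (nhds 0)) :
    Tendsto (fun t => NL μ (g t) (q0 t) (v t)) (cocompact ℝ) (nhds 0) := by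
  obtain ⟨M, hM⟩ := bdd_of_tendsto hvc hv
  refine squeeze_zero_norm
    (a := fun t => (M + |μ| * B) * |v t| + |μ| * B * (2 * sch t)) ?_ ?_
  · intro t
    have hM0 : 0 ≤ M := (abs_nonneg _).trans (hM 0)
    have hB0 : 0 ≤ B := (abs_nonneg _).trans (hgB 0)
    have h1 := NL_lip (μ := μ) (q := q0 t) (hM t) (b := 0) (by simpa using hM0) (hgB t)
    rw [sub_zero] at h1
    have h2 := NL_zero (μ := μ) (q := q0 t) (hgB t)
    have h3 : |μ| * B * |Real.sin (q0 t)| ≤ |μ| * B * (2 * sch t) := by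
      gcongr; exact abs_sin_q0 t
    have h4 := abs_add_le (NL μ (g t) (q0 t) (v t) - NL μ (g t) (q0 t) 0) (NL μ (g t) (q0 t) 0)
    rw [sub_add_cancel] at h4
    rw [Real.norm_eq_abs]; linarith
  · have h1 := (hv.abs).const_mul (M + |μ| * B)
    have h2 := (sch_tendsto.const_mul 2).const_mul (|μ| * B)
    simpa using h1.add h2

lemma LinEq.sub {v1 w1 k1 v2 w2 k2 : ℝ → ℝ} {β1 β2 D1 D2 : ℝ} (h1 : LinEq v1 w1 k1 β1)
    (h2 : LinEq v2 w2 k2 β2) (b1 : ∀ t, |v1 t| ≤ D1) (b2 : ∀ t, |v2 t| ≤ D2) :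
    LinEq (fun t => v1 t - v2 t) (fun t => w1 t - w2 t) (fun t => k1 t - k2 t) (β1 - β2) := by
  have c1 : Continuous v1 := continuous_iff_continuousAt.2 fun t => (h1.1 t).continuousAt
  have c2 : Continuous v2 := continuous_iff_continuousAt.2 fun t => (h2.1 t).continuousAt
  refine ⟨fun t => (h1.1 t).sub (h2.1 t), fun t => ?_, ?_⟩
  · refine ((h1.2.1 t).sub (h2.2.1 t)).congr_deriv ?_
    ring
  · simp_rw [sub_mul]
    rw [integral_sub (integrable_bdd_mul c1 psi0_integrable b1)
      (integrable_bdd_mul c2 psi0_integrable b2), h1.2.2, h2.2.2, sub_zero]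

/-- difference estimate for solutions of linear problems with nonlinear right-hand sides -/
lemma diff_est {μ B r D : ℝ} {g a b v1 w1 v2 w2 : ℝ → ℝ} {β1 β2 D1 D2 : ℝ}
    (hg : Continuous g) (hgB : ∀ t, |g t| ≤ B) (ca : Continuous a) (cb : Continuous b)
    (ha : ∀ t, |a t| ≤ r) (hb : ∀ t, |b t| ≤ r) (hD : ∀ t, |a t - b t| ≤ D)
    (hκ : KK * (r + |μ| * B) ≤ 1 / 2)
    (h1 : LinEq v1 w1 (fun t => NL μ (g t) (q0 t) (a t)) β1)
    (h2 : LinEq v2 w2 (fun t => NL μ (g t) (q0 t) (b t)) β2)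
    (b1 : ∀ t, |v1 t| ≤ D1) (b2 : ∀ t, |v2 t| ≤ D2) :
    (∀ t, |v1 t - v2 t| ≤ D / 2) ∧ |β1 - β2| ≤ D / 2 := by
  have hD0 : 0 ≤ D := (abs_nonneg _).trans (hD 0)
  have hr0 : 0 ≤ r := (abs_nonneg _).trans (ha 0)
  have hB0 : 0 ≤ B := (abs_nonneg _).trans (hgB 0)
  have h := apriori (D := D1 + D2) (M := (r + |μ| * B) * D) (h1.sub h2 b1 b2)
    ((NL_continuous hg ca).sub (NL_continuous hg cb))
    (fun t => (abs_sub _ _).trans (add_le_add (b1 t) (b2 t)))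
    (fun t => (NL_lip (ha t) (hb t) (hgB t)).trans (by gcongr; exact hD t))
  have e : KK * ((r + |μ| * B) * D) ≤ D / 2 := by
    have := mul_le_mul_of_nonneg_right hκ hD0
    linarith
  exact ⟨fun t => (h.1 t).trans e, h.2.trans e⟩

lemma core_unique {μ B r : ℝ} {g v1 w1 v2 w2 : ℝ → ℝ} {β1 β2 : ℝ}
    (hg : Continuous g) (hgB : ∀ t, |g t| ≤ B)
    (ha : ∀ t, |v1 t| ≤ r) (hb : ∀ t, |v2 t| ≤ r)
    (hκ : KK * (r + |μ| * B) ≤ 1 / 2)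
    (h1 : LinEq v1 w1 (fun t => NL μ (g t) (q0 t) (v1 t)) β1)
    (h2 : LinEq v2 w2 (fun t => NL μ (g t) (q0 t) (v2 t)) β2) :
    v1 = v2 ∧ β1 = β2 := by
  have c1 : Continuous v1 := continuous_iff_continuousAt.2 fun t => (h1.1 t).continuousAt
  have c2 : Continuous v2 := continuous_iff_continuousAt.2 fun t => (h2.1 t).continuousAt
  have step : ∀ D, (∀ t, |v1 t - v2 t| ≤ D) →
      (∀ t, |v1 t - v2 t| ≤ D / 2) ∧ |β1 - β2| ≤ D / 2 := fun D hD =>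
    diff_est hg hgB c1 c2 ha hb hD hκ h1 h2 ha hb
  have hbdd : BddAbove (Set.range fun t => |v1 t - v2 t|) := by
    refine ⟨r + r, ?_⟩
    rintro _ ⟨t, rfl⟩
    exact (abs_sub _ _).trans (add_le_add (ha t) (hb t))
  set D := ⨆ t, |v1 t - v2 t| with hDdef
  have hD : ∀ t, |v1 t - v2 t| ≤ D := fun t => le_ciSup hbdd t
  have hD2 : D ≤ D / 2 := ciSup_le (step D hD).1
  have hD0 : D ≤ 0 := by linarith
  constructor
  · funext t
    have := abs_nonpos_iff.1 ((hD t).trans hD0)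
    linarith
  · have := abs_nonpos_iff.1 ((step D hD).2.trans (by linarith))
    linarith

open ZeroAtInftyContinuousMap in
lemma c0_dist_le {v w : ZeroAtInftyContinuousMap ℝ ℝ} {D : ℝ} (hD : 0 ≤ D) :
    dist v w ≤ D ↔ ∀ t, |v t - w t| ≤ D := by
  rw [← dist_toBCF_eq_dist, BoundedContinuousFunction.dist_le hD]
  rfl

lemma core_exists {μ B : ℝ} {g : ℝ → ℝ} (hg : Continuous g) (hgB : ∀ t, |g t| ≤ B)
    (hκ : KK * (2 * KK * B * |μ| + |μ| * B) ≤ 1 / 2) :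
    ∃ (v w : ℝ → ℝ) (β : ℝ), LinEq v w (fun t => NL μ (g t) (q0 t) (v t)) β ∧
      (∀ t, |v t| ≤ 2 * KK * B * |μ|) ∧ Tendsto v (cocompact ℝ) (nhds 0) := by
  have hB0 : 0 ≤ B := (abs_nonneg _).trans (hgB 0)
  have hK := KK_pos
  set r := 2 * KK * B * |μ| with hr
  have hr0 : 0 ≤ r := by positivity
  have hex := fun v : ZeroAtInftyContinuousMap ℝ ℝ =>
    linExists (NL_continuous (μ := μ) hg v.continuous)
      (NL_tendsto (μ := μ) hgB v.continuous v.zero_at_infty')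
  choose V W β hL hV using hex
  have hVc : ∀ v, Continuous (V v) := fun v =>
    continuous_iff_continuousAt.2 fun t => ((hL v).1 t).continuousAt
  let Φ : ZeroAtInftyContinuousMap ℝ ℝ → ZeroAtInftyContinuousMap ℝ ℝ :=
    fun v => ⟨⟨V v, hVc v⟩, hV v⟩
  have hΦ : ∀ v t, Φ v t = V v t := fun v t => rfl
  have hbd : ∀ v, ∃ M, ∀ t, |V v t| ≤ M := fun v => bdd_of_tendsto (hVc v) (hV v)
  let s : Set (ZeroAtInftyContinuousMap ℝ ℝ) := Metric.closedBall 0 r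
  have hs : ∀ v, v ∈ s ↔ ∀ t, |v t| ≤ r := by
    intro v
    rw [Metric.mem_closedBall, c0_dist_le hr0]
    simp
  have hlip : ∀ v ∈ s, ∀ w ∈ s, dist (Φ v) (Φ w) ≤ dist v w / 2 := by
    intro v hv w hw
    obtain ⟨M1, hM1⟩ := hbd v
    obtain ⟨M2, hM2⟩ := hbd w
    rw [c0_dist_le (by positivity)]
    exact (diff_est hg hgB v.continuous w.continuous ((hs v).1 hv) ((hs w).1 hw)
      ((c0_dist_le dist_nonneg).1 le_rfl) hκ (hL v) (hL w) hM1 hM2).1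
  have h0s : (0 : ZeroAtInftyContinuousMap ℝ ℝ) ∈ s := Metric.mem_closedBall_self hr0
  have hΦ0 : dist (Φ 0) 0 ≤ r / 2 := by
    rw [c0_dist_le (by positivity)]
    intro t
    obtain ⟨M1, hM1⟩ := hbd 0
    have := (apriori (M := |μ| * B) (hL 0) (NL_continuous hg (map_continuous _)) hM1 (fun t => by
      refine (NL_zero (hgB t)).trans ?_
      exact mul_le_of_le_one_right (by positivity) (Real.abs_sin_le_one _))).1 t
    have e : KK * (|μ| * B) = r / 2 := by rw [hr]; ring
    rw [e] at this
    simpa [hΦ] using this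
  have hmaps : Set.MapsTo Φ s s := by
    intro v hv
    have h1 := hlip v hv 0 h0s
    have h2 : dist v 0 ≤ r := hv
    have h3 := dist_triangle (Φ v) (Φ 0) 0
    rw [Metric.mem_closedBall]; linarith
  have hcontr : ContractingWith (1 / 2) (hmaps.restrict Φ s s) := by
    refine ⟨by norm_num, LipschitzWith.of_dist_le_mul fun x y => ?_⟩
    have := hlip x x.2 y y.2
    simp only [Subtype.dist_eq, Set.MapsTo.val_restrict_apply]
    push_cast
    linarith
  obtain ⟨v, hvs, hfix, -⟩ := hcontr.exists_fixedPoint' (x := 0)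
    Metric.isClosed_closedBall.isComplete hmaps h0s (edist_ne_top _ _)
  have hVv : V v = v := by
    funext t
    rw [← hΦ, hfix]
  have h := hL v
  rw [hVv] at h
  exact ⟨v, W v, β v, h, (hs v).1 hvs, v.zero_at_infty'⟩

end ModHet

/-- Existence and uniqueness of the modified 1-bump pseudo-heteroclinic pairs
`(Q^μ_{A,θ}, α^μ_{A,θ})`, with constants depending only on a bound `B` for `sup |f|`. -/
theorem modified_pseudo_heteroclinic_exists_unique (B : ℝ) (hB : 0 < B) :
    ∃ μ0 > (0:ℝ), ∃ C > (0:ℝ),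
      ∀ (n : ℕ) (ω : Fin n → ℝ) (f : (Fin n → ℝ) → ℝ),
        Continuous f →
        (∀ (k : Fin n → ℤ) (x : Fin n → ℝ),
          f (x + fun i => 2 * Real.pi * (k i : ℝ)) = f x) →
        (∀ x, |f x| ≤ B) →
        ∀ (μ : ℝ), |μ| < μ0 → ∀ (A : Fin n → ℝ) (θ : ℝ),
          ∃! Qα : (ℝ → ℝ) × ℝ, IsModPseudoHet n ω f μ A θ C Qα.1 Qα.2 := by
  have hK := ModHet.KK_pos
  set K := ModHet.KK with hKdef
  refine ⟨1 / (2 * K * (2 * K * B + B)), by positivity, 2 * K * B, by positivity, ?_⟩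
  intro n ω f hf _ hfB μ hμ A θ
  have hκ : K * (2 * K * B * |μ| + |μ| * B) ≤ 1 / 2 := by
    rw [lt_div_iff₀ (by positivity)] at hμ
    linarith
  set g : ℝ → ℝ := fun t => f (fun i => ω i * (t + θ) + A i) with hg
  have hgc : Continuous g := hf.comp (by fun_prop)
  have hgB : ∀ t, |g t| ≤ B := fun t => hfB _
  have toLin : ∀ Q α, IsModPseudoHet n ω f μ A θ (2 * K * B) Q α →
      ModHet.LinEq (fun t => Q (t + θ) - q0 t) (fun t => deriv Q (t + θ) - 2 * ModHet.sch t)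
        (fun t => ModHet.NL μ (g t) (q0 t) (Q (t + θ) - q0 t)) α ∧
      ∀ t, |Q (t + θ) - q0 t| ≤ 2 * K * B * |μ| := by
    rintro Q α ⟨-, hb, hd, hi, -, -⟩
    refine ⟨⟨fun t => ?_, fun t => ?_, ?_⟩, fun t => ?_⟩
    · exact ((hd (t + θ)).1.comp_add_const t θ).sub (ModHet.q0_hasDerivAt t)
    · refine (((hd (t + θ)).2.comp_add_const t θ).sub (ModHet.q0_hasDerivAt2 t)).congr_deriv ?_
      unfold ModHet.NL
      rw [← ModHet.cos_q0, add_sub_cancel_right]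
      simp only [hg, add_sub_cancel]
      ring
    · rw [← integral_add_right_eq_self _ θ] at hi
      simpa using hi
    · simpa using hb (t + θ)
  obtain ⟨v, w, β, hL, hb, h0⟩ := ModHet.core_exists hgc hgB hκ
  refine ⟨(fun t => q0 (t - θ) + v (t - θ), β), ?_, ?_⟩
  · have hd : ∀ t, HasDerivAt (fun t => q0 (t - θ) + v (t - θ))
        (2 * ModHet.sch (t - θ) + w (t - θ)) t := fun t =>
      ((ModHet.q0_hasDerivAt (t - θ)).comp_sub_const t θ).add ((hL.1 (t - θ)).comp_sub_const t θ)
    have hderiv : deriv (fun t => q0 (t - θ) + v (t - θ))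
        = fun t => 2 * ModHet.sch (t - θ) + w (t - θ) := funext fun t => (hd t).deriv
    have hbot : Tendsto (fun t : ℝ => t - θ) atBot atBot := tendsto_atBot_add_const_right _ (-θ) tendsto_id
    have htop : Tendsto (fun t : ℝ => t - θ) atTop atTop := tendsto_atTop_add_const_right _ (-θ) tendsto_id
    refine ⟨continuous_iff_continuousAt.2 fun t => (hd t).continuousAt, fun t => ?_,
      fun t => ⟨?_, ?_⟩, ?_, ?_, ?_⟩
    · simpa using hb (t - θ)
    · rw [hderiv]; exact hd t
    · dsimp only
      rw [hderiv]
      refine (((ModHet.q0_hasDerivAt2 (t - θ)).comp_sub_const t θ).add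
        ((hL.2.1 (t - θ)).comp_sub_const t θ)).congr_deriv ?_
      unfold ModHet.NL
      rw [← ModHet.cos_q0]
      simp only [hg, sub_add_cancel]
      ring
    · have := hL.2.2
      rw [← integral_sub_right_eq_self _ θ] at this
      simpa using this
    · simpa using (ModHet.q0_bot.comp hbot).add ((h0.mono_left atBot_le_cocompact).comp hbot)
    · simpa using (ModHet.q0_top.comp htop).add ((h0.mono_left atTop_le_cocompact).comp htop)
  · rintro ⟨Q, α⟩ hQ
    obtain ⟨hL2, hb2⟩ := toLin Q α hQ
    obtain ⟨e1, e2⟩ := ModHet.core_unique hgc hgB hb2 hb hκ hL2 hL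
    refine Prod.ext ?_ e2
    funext t
    have := congrFun e1 (t - θ)
    simp only [sub_add_cancel] at this
    simp only
    linarith
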